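/- arXiv:math/9908088 — 11 statements merged into one kernel-verified Lean document; each statement's English description precedes it below -/
import Mathlib

section
/- There do not exist elements n, d, u, v of ℤ[√−5] with d ≠ 0 such that 2·n = (1+√−5)·d and u·n + v·d = 1. (Equivalently: the element p = (1+√−5)/2 of the fraction field of ℤ[√−5] admits no coprime factorization p = n/d over ℤ[√−5].) -/
/-- No element of `ℤ[√-5]` has norm `2`. -/
theorem Zsqrtd.norm_neg_five_ne_two (t : ℤ√(-5)) : t.norm ≠ 2 := by
  intro h
  rw [Zsqrtd.norm_def] at h
  have him : t.im = 0 := by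
    by_contra h0
    nlinarith [mul_self_nonneg t.re, Int.one_le_abs h0, abs_mul_abs_self t.im]
  rw [him] at h
  have hre : |t.re| < 2 := by
    by_contra! h0
    nlinarith [abs_mul_abs_self t.re]
  obtain ⟨h1, h2⟩ := abs_lt.mp hre
  interval_cases t.re <;> omega

/-- Every element of the ideal `(2, 1 + √-5)` of `ℤ[√-5]` has even norm. -/
theorem Zsqrtd.two_dvd_norm_neg_five (u v : ℤ√(-5)) :
    2 ∣ (u * (1 + Zsqrtd.sqrtd) + 2 * v).norm := by
  refine ⟨3 * u.norm + 2 * v.norm + 2 * ((u.re - 5 * u.im) * v.re + 5 * (u.re + u.im) * v.im), ?_⟩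
  have h2 : (2 : ℤ√(-5)) = ⟨2, 0⟩ := rfl
  simp only [Zsqrtd.norm_def, h2, Zsqrtd.re_add, Zsqrtd.im_add, Zsqrtd.re_mul, Zsqrtd.im_mul,
    Zsqrtd.re_one, Zsqrtd.im_one, Zsqrtd.re_sqrtd, Zsqrtd.im_sqrtd]
  ring

/-- The plant `p = (1 + √-5)/2` over `ℤ[√-5]` admits no coprime factorization:
there are no `n, d, u, v ∈ ℤ[√-5]` with `d ≠ 0`, `2·n = (1 + √-5)·d` and
`u·n + v·d = 1`. -/
theorem no_coprime_factorization_zsqrtd_neg5 :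
    ¬ ∃ n d u v : ℤ√(-5), d ≠ 0 ∧
      2 * n = (1 + Zsqrtd.sqrtd) * d ∧ u * n + v * d = 1 := by
  rintro ⟨n, d, u, v, -, hnd, huv⟩
  -- `t` generates the ideal `(2, 1 + √-5)`
  set t := u * (1 + Zsqrtd.sqrtd) + 2 * v
  have htd : t * d = 2 := by linear_combination 2 * huv - u * hnd
  have htn : t * n = 1 + Zsqrtd.sqrtd := by
    linear_combination (1 + Zsqrtd.sqrtd) * huv + v * hnd
  have h4 : t.norm * d.norm = 4 := by rw [← Zsqrtd.norm_mul, htd]; rfl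
  have h6 : t.norm * n.norm = 6 := by rw [← Zsqrtd.norm_mul, htn]; rfl
  have hdvd : t.norm ∣ 2 := ⟨n.norm - d.norm, by linear_combination h4 - h6⟩
  exact Zsqrtd.norm_neg_five_ne_two t <| Int.dvd_antisymm
    (Zsqrtd.norm_nonneg (by norm_num) t) (by norm_num) hdvd (Zsqrtd.two_dvd_norm_neg_five u v)
end

section
/- Let K be the fraction field of R = ℤ[√−5], and in K set p = (1+√−5)/2 and c = (−1+√−5)/2. Then 1 + p·c ≠ 0, and each of (1+p·c)⁻¹, p·(1+p·c)⁻¹, c·(1+p·c)⁻¹ and p·c·(1+p·c)⁻¹ lies in the image of R in K. (Thus c is a stabilizing controller of the plant p: all four entries of the closed-loop transfer matrix are stable.) -/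
/-- `ℤ√d` is an integral domain whenever `d < 0`. -/
theorem Zsqrtd.isDomain_of_neg {d : ℤ} (hd : d < 0) : IsDomain (ℤ√d) :=
  have : NoZeroDivisors (ℤ√d) :=
    ⟨fun {a b} h => by
      have hnorm : a.norm * b.norm = 0 := by
        rw [← Zsqrtd.norm_mul, h, Zsqrtd.norm_zero]
      rcases mul_eq_zero.mp hnorm with h' | h'
      · exact Or.inl ((Zsqrtd.norm_eq_zero_iff hd a).mp h')
      · exact Or.inr ((Zsqrtd.norm_eq_zero_iff hd b).mp h')⟩
  NoZeroDivisors.to_isDomain _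

instance : IsDomain (ℤ√(-5)) := Zsqrtd.isDomain_of_neg (by norm_num)

/-- In any characteristic-zero field over `ℤ[√-5]`, the controller `(-1+√-5)/2` stabilizes the
plant `(1+√-5)/2`. -/
theorem stabilizing_controller_of_algebra (K : Type*) [Field K] [CharZero K]
    [Algebra (ℤ√(-5)) K] :
    let p : K := algebraMap (ℤ√(-5)) K (1 + Zsqrtd.sqrtd) / algebraMap (ℤ√(-5)) K 2
    let c : K := algebraMap (ℤ√(-5)) K (-1 + Zsqrtd.sqrtd) / algebraMap (ℤ√(-5)) K 2
    1 + p * c ≠ 0 ∧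
    (1 + p * c)⁻¹ ∈ Set.range (algebraMap (ℤ√(-5)) K) ∧
    p * (1 + p * c)⁻¹ ∈ Set.range (algebraMap (ℤ√(-5)) K) ∧
    c * (1 + p * c)⁻¹ ∈ Set.range (algebraMap (ℤ√(-5)) K) ∧
    p * c * (1 + p * c)⁻¹ ∈ Set.range (algebraMap (ℤ√(-5)) K) := by
  intro p c
  have hs : algebraMap (ℤ√(-5)) K Zsqrtd.sqrtd * algebraMap (ℤ√(-5)) K Zsqrtd.sqrtd = -5 := by
    rw [← map_mul, Zsqrtd.dmuld, map_intCast]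
    norm_num
  have hp : p = (1 + algebraMap (ℤ√(-5)) K Zsqrtd.sqrtd) / 2 := by simp only [p, map_add, map_one, map_ofNat]
  have hc : c = (-1 + algebraMap (ℤ√(-5)) K Zsqrtd.sqrtd) / 2 := by simp only [c, map_add, map_neg, map_one, map_ofNat]
  have hpc : p * c = -3 / 2 := by
    rw [hp, hc]
    field_simp
    linear_combination hs
  have hinv : (1 + p * c)⁻¹ = -2 := by
    rw [hpc]
    norm_num
  refine ⟨?_, ⟨-2, ?_⟩, ⟨-(1 + Zsqrtd.sqrtd), ?_⟩, ⟨1 - Zsqrtd.sqrtd, ?_⟩, ⟨3, ?_⟩⟩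
  · rw [hpc]
    norm_num
  · rw [hinv, map_neg, map_ofNat]
  · rw [hinv, hp, map_neg, map_add, map_one]
    field_simp
  · rw [hinv, hc, map_sub, map_one]
    field_simp
    ring
  · rw [hinv, hpc, map_ofNat]
    norm_num

/-- In the fraction field `K` of `R = ℤ[√-5]`, the controller `c = (-1+√-5)/2`
stabilizes the plant `p = (1+√-5)/2`: one has `1 + p·c ≠ 0` and all four
closed-loop transfer functions `(1+pc)⁻¹`, `p(1+pc)⁻¹`, `c(1+pc)⁻¹`,
`pc(1+pc)⁻¹` are stable, i.e. lie in the image of `R` in `K`. -/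
theorem stabilizing_controller_zsqrtd_neg5 :
    let R := ℤ√(-5)
    let K := FractionRing R
    let p : K := algebraMap R K (1 + Zsqrtd.sqrtd) / algebraMap R K 2
    let c : K := algebraMap R K (-1 + Zsqrtd.sqrtd) / algebraMap R K 2
    1 + p * c ≠ 0 ∧
    (1 + p * c)⁻¹ ∈ Set.range (algebraMap R K) ∧
    p * (1 + p * c)⁻¹ ∈ Set.range (algebraMap R K) ∧
    c * (1 + p * c)⁻¹ ∈ Set.range (algebraMap R K) ∧
    p * c * (1 + p * c)⁻¹ ∈ Set.range (algebraMap R K) := by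
  exact stabilizing_controller_of_algebra (FractionRing (ℤ√(-5)))
end

section
/- Let K be the fraction field of R = ℤ[√−5]. For every nonzero q ∈ K there exist λ₁, λ₂ ∈ R with λ₁ + λ₂ = 1 such that λ₁·q⁻¹ lies in the image of R in K and λ₂·q lies in the image of R in K. (This is the algebraic content of the proposition that, over A = ℤ[√5 i] with Z = {0}, every transfer function in ℚ(√5 i) is stabilizable.) -/
/-- If `g ^ 2` divides `5 * X ^ 2`, then `g` divides `X`, because `5` is squarefree. -/
theorem Int.dvd_of_sq_dvd_five_mul_sq {g X : ℤ} (hg : g ≠ 0) (h : g ^ 2 ∣ 5 * X ^ 2) :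
    g ∣ X := by
  obtain ⟨k, hk⟩ := h
  have h5 : g ∣ 5 * X := by
    rw [← Int.pow_dvd_pow_iff two_ne_zero]
    exact ⟨5 * k, by linear_combination 5 * hk⟩
  obtain ⟨e, he⟩ := h5
  have he2 : e ^ 2 = 5 * k := by
    apply mul_left_cancel₀ (pow_ne_zero 2 hg)
    linear_combination 5 * hk - (5 * X + g * e) * he
  have h5e : (5 : ℤ) ∣ e :=
    Prime.dvd_of_dvd_pow (by norm_num) (Dvd.intro k he2.symm)
  obtain ⟨f, rfl⟩ := h5e
  exact ⟨f, by linarith⟩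

/-- If `4` divides `b ^ 2 + 5 * r ^ 2`, then `b` and `r` are even. -/
theorem Int.even_and_even_of_sq_add_five_mul_sq {b r k : ℤ} (h : b ^ 2 + 5 * r ^ 2 = 4 * k) :
    Even b ∧ Even r := by
  rcases Int.even_or_odd' b with ⟨i, rfl | rfl⟩ <;> rcases Int.even_or_odd' r with ⟨j, rfl | rfl⟩
  · simp
  all_goals
    ring_nf at h
    omega

/-- The primitive quadratic equation of `(u + v√-5) / m`: after division by its content `g`, the
coefficients are `a = m² / g`, `-2 * s` and `c = (u² + 5v²) / g`, where `s + t√-5` is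
`m * (u + v√-5) / g`. -/
theorem Int.exists_primitive_quadratic {m : ℤ} (hm : m ≠ 0) (u v : ℤ) :
    ∃ a c s t x y z : ℤ, a * u = m * s ∧ a * v = m * t ∧ s * u + 5 * (t * v) = m * c ∧
      s * v = t * u ∧ x * a + 2 * (y * s) + z * c = 1 := by
  obtain ⟨g, hgdef⟩ : ∃ g : ℤ, g = Int.gcd (Int.gcd (m ^ 2) (2 * u * m)) (u ^ 2 + 5 * v ^ 2) :=
    ⟨_, rfl⟩
  have hd : g ∣ (Int.gcd (m ^ 2) (2 * u * m) : ℤ) := hgdef ▸ Int.gcd_dvd_left ..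
  obtain ⟨a, ha⟩ := hd.trans (Int.gcd_dvd_left ..)
  obtain ⟨b, hb⟩ := hd.trans (Int.gcd_dvd_right ..)
  obtain ⟨c, hc⟩ : g ∣ u ^ 2 + 5 * v ^ 2 := hgdef ▸ Int.gcd_dvd_right ..
  have hg : g ≠ 0 := by
    rintro rfl
    exact hm (pow_eq_zero_iff two_ne_zero |>.mp (by simpa using ha))
  obtain ⟨x, y, z, hbez⟩ : ∃ x y z : ℤ,
      g = x * m ^ 2 + y * (2 * u * m) + z * (u ^ 2 + 5 * v ^ 2) := by
    obtain ⟨i, j, hij⟩ : ∃ i j, (Int.gcd (m ^ 2) (2 * u * m) : ℤ) = m ^ 2 * i + 2 * u * m * j :=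
      ⟨_, _, Int.gcd_eq_gcd_ab ..⟩
    obtain ⟨k, l, hkl⟩ : ∃ k l, g = Int.gcd (m ^ 2) (2 * u * m) * k + (u ^ 2 + 5 * v ^ 2) * l :=
      ⟨_, _, hgdef.trans (Int.gcd_eq_gcd_ab ..)⟩
    exact ⟨i * k, j * k, l, by linear_combination hkl + k * hij⟩
  obtain ⟨r, hr⟩ : g ∣ 2 * v * m :=
    Int.dvd_of_sq_dvd_five_mul_sq hg
      ⟨4 * (a * c) - b ^ 2, by
        linear_combination 4 * (u ^ 2 + 5 * v ^ 2) * ha + 4 * g * a * hc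
          - (2 * u * m + g * b) * hb⟩
  have hbr : b ^ 2 + 5 * r ^ 2 = 4 * (a * c) := by
    apply mul_left_cancel₀ (pow_ne_zero 2 hg)
    linear_combination 4 * (u ^ 2 + 5 * v ^ 2) * ha + 4 * g * a * hc
      - (2 * u * m + g * b) * hb - 5 * (2 * v * m + g * r) * hr
  obtain ⟨⟨s, rfl⟩, ⟨t, rfl⟩⟩ := Int.even_and_even_of_sq_add_five_mul_sq hbr
  have hs : u * m = g * s := by linarith
  have ht : v * m = g * t := by linarith
  refine ⟨a, c, s, t, x, y, z, ?_, ?_, ?_, ?_, ?_⟩ <;> apply mul_left_cancel₀ hg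
  · linear_combination m * hs - u * ha
  · linear_combination m * ht - v * ha
  · linear_combination m * hc - u * hs - 5 * v * ht
  · linear_combination u * ht - v * hs
  · linear_combination -hbez - x * ha - 2 * y * hs - z * hc

/-- Every fraction over `ℤ[√-5]` has a nonzero integer denominator. -/
theorem Zsqrtd.exists_eq_div_intCast (q : FractionRing (ℤ√(-5))) :
    ∃ (w : ℤ√(-5)) (m : ℤ), m ≠ 0 ∧
      q = algebraMap (ℤ√(-5)) (FractionRing (ℤ√(-5))) w /
        algebraMap (ℤ√(-5)) (FractionRing (ℤ√(-5))) (m : ℤ√(-5)) := by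
  obtain ⟨n, d, hd, rfl⟩ := IsFractionRing.div_surjective (A := ℤ√(-5)) q
  have hd0 : d ≠ 0 := nonZeroDivisors.ne_zero hd
  have hstar : algebraMap (ℤ√(-5)) (FractionRing (ℤ√(-5))) (star d) ≠ 0 := by
    simpa using hd0
  refine ⟨n * star d, d.norm, ?_, ?_⟩
  · rwa [Ne, Zsqrtd.norm_eq_zero_iff (by norm_num)]
  · rw [Zsqrtd.norm_eq_mul_conj, map_mul, map_mul, mul_div_mul_right _ _ hstar]

/-- Over `A = ℤ[√-5]` (with trivial causality constraint), every nonzero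
transfer function `q` in the fraction field `K` is stabilizable: there exist
`λ₁, λ₂ ∈ R` with `λ₁ + λ₂ = 1` such that `λ₁·q⁻¹` and `λ₂·q` both lie in the
image of `R` in `K` (the generalized elementary factors sum to `R`). -/
theorem every_nonzero_transfer_function_stabilizable_zsqrtd_neg5
    (q : FractionRing (ℤ√(-5))) (hq : q ≠ 0) :
    ∃ lam1 lam2 : ℤ√(-5), lam1 + lam2 = 1 ∧
      algebraMap (ℤ√(-5)) (FractionRing (ℤ√(-5))) lam1 * q⁻¹ ∈
        Set.range (algebraMap (ℤ√(-5)) (FractionRing (ℤ√(-5)))) ∧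
      algebraMap (ℤ√(-5)) (FractionRing (ℤ√(-5))) lam2 * q ∈
        Set.range (algebraMap (ℤ√(-5)) (FractionRing (ℤ√(-5)))) := by
  obtain ⟨w, m, hm, rfl⟩ := Zsqrtd.exists_eq_div_intCast q
  obtain ⟨a, c, s, t, x, y, z, hu, hv, hc, hst, hbez⟩ :=
    Int.exists_primitive_quadratic hm w.re w.im
  have hmK : algebraMap (ℤ√(-5)) (FractionRing (ℤ√(-5))) (m : ℤ√(-5)) ≠ 0 := by
    simpa using hm
  have hwK : algebraMap (ℤ√(-5)) (FractionRing (ℤ√(-5))) w ≠ 0 := (div_ne_zero_iff.mp hq).1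
  have haw : (a : ℤ√(-5)) * w = m * ⟨s, t⟩ := by
    ext <;> simp [hu, hv]
  have hcw : (⟨s, -t⟩ : ℤ√(-5)) * w = m * c := by
    ext <;> simp <;> linarith
  refine ⟨z * c + y * ⟨s, t⟩, x * a + y * ⟨s, -t⟩, ?_, ⟨z * ⟨s, -t⟩ + y * a, ?_⟩,
    ⟨x * ⟨s, t⟩ + y * c, ?_⟩⟩
  · ext <;> simp
    linarith
  · rw [inv_div, mul_div_assoc', eq_div_iff hwK, ← map_mul, ← map_mul]
    congr 1
    linear_combination (z : ℤ√(-5)) * hcw + (y : ℤ√(-5)) * haw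
  · rw [mul_div_assoc', eq_div_iff hmK, ← map_mul, ← map_mul]
    congr 1
    linear_combination -(x : ℤ√(-5)) * haw - (y : ℤ√(-5)) * hcw
end

section
/- Let x, y be integers with gcd(x, y) = 1, 2 ≤ x < y, and x·y − 1 not a perfect square. Let R = ℤ[√−(xy−1)] with ω = √−(xy−1), and let K be its fraction field. Then (1+ω)·(1−ω) = x·y in R, and there exist λ₁, λ₂ ∈ R with λ₁ + λ₂ = 1 such that λ₁·(x/(1+ω)) lies in the image of R in K and λ₂·((1+ω)/x) lies in the image of R in K. (Hence the plant p = (1+ω)/x is stabilizable.) -/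
/-- If `s * t = x * y` in a domain with `x` and `y` comaximal, then the fraction `s / x` satisfies
the generalized-elementary-factor stabilizability criterion. -/
theorem exists_add_eq_one_of_mul_eq_mul_of_isCoprime {R K : Type*} [CommRing R] [IsDomain R]
    [Field K] [Algebra R K] [IsFractionRing R K] {x y s t : R} (hst : s * t = x * y)
    (hxy : IsCoprime x y) (hx : x ≠ 0) (hs : s ≠ 0) :
    ∃ l₁ l₂ : R, l₁ + l₂ = 1 ∧
      algebraMap R K l₁ * (algebraMap R K x / algebraMap R K s) ∈ Set.range (algebraMap R K) ∧
      algebraMap R K l₂ * (algebraMap R K s / algebraMap R K x) ∈ Set.range (algebraMap R K) := by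
  obtain ⟨a, b, hab⟩ := hxy
  have hxK : algebraMap R K x ≠ 0 := by simpa using hx
  have hsK : algebraMap R K s ≠ 0 := by simpa using hs
  refine ⟨b * y, a * x, by rw [add_comm, hab], ⟨b * t, ?_⟩, ⟨a * s, ?_⟩⟩
  · rw [← mul_div_assoc, eq_div_iff hsK, ← map_mul, ← map_mul]
    exact congrArg _ (by linear_combination b * hst)
  · rw [← mul_div_assoc, eq_div_iff hxK, ← map_mul, ← map_mul]
    exact congrArg _ (by ring)

/-- For coprime integers `2 ≤ x < y` with `x·y - 1` not a perfect square, in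
`R = ℤ[√-(xy-1)]` with `ω = √-(xy-1)` one has `(1+ω)·(1-ω) = x·y`, and the
plant `p = (1+ω)/x` over the fraction field `K` of `R` is stabilizable: there
exist `λ₁, λ₂ ∈ R` with `λ₁ + λ₂ = 1` such that `λ₁·(x/(1+ω))` and
`λ₂·((1+ω)/x)` lie in the image of `R` in `K`. -/
theorem stabilizable_plant_zsqrtd (x y : ℤ) (hgcd : Int.gcd x y = 1)
    (hx : 2 ≤ x) (hxy : x < y) (hsq : ¬ IsSquare (x * y - 1)) :
    haveI : IsDomain (ℤ√(-(x * y - 1))) :=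
      Zsqrtd.isDomain_of_neg (by nlinarith)
    (1 + Zsqrtd.sqrtd) * (1 - Zsqrtd.sqrtd) =
        ((x : ℤ√(-(x * y - 1))) * (y : ℤ√(-(x * y - 1)))) ∧
    ∃ lam1 lam2 : ℤ√(-(x * y - 1)), lam1 + lam2 = 1 ∧
      algebraMap (ℤ√(-(x * y - 1))) (FractionRing (ℤ√(-(x * y - 1)))) lam1 *
          (algebraMap (ℤ√(-(x * y - 1))) (FractionRing (ℤ√(-(x * y - 1))))
              (x : ℤ√(-(x * y - 1))) /
            algebraMap (ℤ√(-(x * y - 1))) (FractionRing (ℤ√(-(x * y - 1))))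
              (1 + Zsqrtd.sqrtd)) ∈
        Set.range (algebraMap (ℤ√(-(x * y - 1))) (FractionRing (ℤ√(-(x * y - 1))))) ∧
      algebraMap (ℤ√(-(x * y - 1))) (FractionRing (ℤ√(-(x * y - 1)))) lam2 *
          (algebraMap (ℤ√(-(x * y - 1))) (FractionRing (ℤ√(-(x * y - 1))))
              (1 + Zsqrtd.sqrtd) /
            algebraMap (ℤ√(-(x * y - 1))) (FractionRing (ℤ√(-(x * y - 1))))
              (x : ℤ√(-(x * y - 1)))) ∈
        Set.range (algebraMap (ℤ√(-(x * y - 1))) (FractionRing (ℤ√(-(x * y - 1))))) := by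
  have hdom : IsDomain (ℤ√(-(x * y - 1))) := Zsqrtd.isDomain_of_neg (by nlinarith)
  have hmul : (1 + Zsqrtd.sqrtd) * (1 - Zsqrtd.sqrtd) =
      ((x : ℤ√(-(x * y - 1))) * (y : ℤ√(-(x * y - 1)))) := by
    ext <;> simp
  refine ⟨hmul, exists_add_eq_one_of_mul_eq_mul_of_isCoprime hmul ?_ ?_ ?_⟩
  · exact (Int.isCoprime_iff_gcd_eq_one.mpr hgcd).map (Int.castRingHom (ℤ√(-(x * y - 1))))
  · intro h
    have hre := congrArg Zsqrtd.re h
    simp only [Zsqrtd.re_intCast, Zsqrtd.re_zero] at hre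
    omega
  · intro h
    simpa using congrArg Zsqrtd.re h
end

section
/- Let x, y be integers with gcd(x, y) = 1, 2 ≤ x < y, and x·y − 1 not a perfect square, and let R = ℤ[√−(xy−1)] with ω = √−(xy−1). Then there do not exist n, d, u, v ∈ R with d ≠ 0 such that x·n = (1+ω)·d and u·n + v·d = 1. (Equivalently: the plant p = (1+ω)/x has no coprime factorization over R.) -/
/-- For coprime integers `2 ≤ x < y` with `x·y - 1` not a perfect square, the
plant `p = (1+ω)/x` over `R = ℤ[√-(xy-1)]`, `ω = √-(xy-1)`, has no coprime
factorization: there are no `n, d, u, v ∈ R` with `d ≠ 0`,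
`x·n = (1+ω)·d` and `u·n + v·d = 1`. -/
theorem no_coprime_factorization_zsqrtd (x y : ℤ) (hgcd : Int.gcd x y = 1)
    (hx : 2 ≤ x) (hxy : x < y) (hsq : ¬ IsSquare (x * y - 1)) :
    ¬ ∃ n d u v : ℤ√(-(x * y - 1)), d ≠ 0 ∧
      (x : ℤ√(-(x * y - 1))) * n = (1 + Zsqrtd.sqrtd) * d ∧
      u * n + v * d = 1 := by
  rintro ⟨n, d, u, v, -, hnd, huv⟩
  have hxD : x < x * y - 1 := by nlinarith
  -- `g` generates the ideal `(x, 1 + ω)`: `d * g = x` and `n * g = 1 + ω`.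
  obtain ⟨g, hg⟩ : ∃ g, g = u * (1 + Zsqrtd.sqrtd) + v * (x : ℤ√(-(x * y - 1))) := ⟨_, rfl⟩
  have hdg : d * g = x := by
    linear_combination d * hg - u * hnd + (x : ℤ√(-(x * y - 1))) * huv
  have hnorm_d : d.norm * g.norm = x * x := by
    rw [← Zsqrtd.norm_mul, hdg, Zsqrtd.norm_intCast]
  have hnx : (x : ℤ√(-(x * y - 1))) * (n * g) =
      (x : ℤ√(-(x * y - 1))) * (1 + Zsqrtd.sqrtd) := by
    linear_combination g * hnd + (1 + Zsqrtd.sqrtd) * hdg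
  have hng_im : (n * g).im = 1 := by
    have h := congrArg Zsqrtd.im hnx
    simp only [Zsqrtd.im_smul, Zsqrtd.im_add, Zsqrtd.im_one, Zsqrtd.im_sqrtd] at h
    exact mul_left_cancel₀ (by omega : x ≠ 0) (by simpa using h)
  have hng_re : (n * g).re = 1 := by
    have h := congrArg Zsqrtd.re hnx
    simp only [Zsqrtd.re_smul, Zsqrtd.re_add, Zsqrtd.re_one, Zsqrtd.re_sqrtd] at h
    exact mul_left_cancel₀ (by omega : x ≠ 0) (by simpa using h)
  have hnorm_n : n.norm * g.norm = x * y := by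
    rw [← Zsqrtd.norm_mul, Zsqrtd.norm_def, hng_re, hng_im]
    ring
  have hnorm_dvd : g.norm ∣ x := by
    obtain ⟨a, b, hab⟩ := Int.isCoprime_iff_gcd_eq_one.mpr hgcd
    exact ⟨a * d.norm + b * n.norm, by
      linear_combination (-x) * hab - a * hnorm_d - b * hnorm_n⟩
  have hdvd_norm : x ∣ g.norm := by
    have hre : g.re = u.re + u.im + x * (v.re - y * u.im) := by
      rw [hg]; simp; ring
    have him : g.im = u.re + u.im + x * v.im := by
      rw [hg]; simp; ring
    rw [Zsqrtd.norm_def, hre, him]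
    exact ⟨2 * (u.re + u.im) * (v.re - y * u.im) + x * (v.re - y * u.im) ^ 2
      + y * (u.re + u.im + x * v.im) ^ 2 - 2 * (u.re + u.im) * v.im - x * v.im ^ 2, by ring⟩
  have hnorm_nonneg : 0 ≤ g.norm := Zsqrtd.norm_nonneg (by omega) g
  have hnorm : g.norm = x := Int.dvd_antisymm hnorm_nonneg (by omega) hnorm_dvd hdvd_norm
  rw [Zsqrtd.norm_def] at hnorm
  have him : g.im = 0 := by
    by_contra h
    have : 0 < g.im ^ 2 := by positivity
    nlinarith [sq_nonneg g.re]
  rw [him] at hnorm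
  have hre : n.im * g.re = 1 := by
    simpa [him] using hng_im
  rcases Int.eq_one_or_neg_one_of_mul_eq_one (mul_comm n.im g.re ▸ hre) with h | h <;>
    · rw [h] at hnorm
      omega
end

section
/- In the polynomial ring ℝ[X], the ℝ-subalgebra generated by X² and X³ is exactly the set of polynomials whose coefficient of X (degree-one coefficient) is zero: Algebra.adjoin ℝ {X², X³} = {f ∈ ℝ[X] : f.coeff 1 = 0}. -/
open Polynomial

/-- Every power of `X` other than `X` itself lies in the subalgebra generated by `X²` and `X³`. -/
theorem X_pow_mem_adjoin_X_sq_X_cube {R : Type*} [CommSemiring R] {n : ℕ} (hn : n ≠ 1) :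
    (X ^ n : R[X]) ∈ Algebra.adjoin R ({X ^ 2, X ^ 3} : Set R[X]) := by
  have h2 : (X ^ 2 : R[X]) ∈ Algebra.adjoin R ({X ^ 2, X ^ 3} : Set R[X]) :=
    Algebra.subset_adjoin (by simp)
  have h3 : (X ^ 3 : R[X]) ∈ Algebra.adjoin R ({X ^ 2, X ^ 3} : Set R[X]) :=
    Algebra.subset_adjoin (by simp)
  obtain ⟨a, b, rfl⟩ : ∃ a b, n = 2 * a + 3 * b := by
    rcases Nat.even_or_odd' n with ⟨k, rfl | rfl⟩
    · exact ⟨k, 0, by omega⟩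
    · exact ⟨k - 1, 1, by omega⟩
  rw [pow_add, pow_mul, pow_mul]
  exact mul_mem (pow_mem h2 a) (pow_mem h3 b)

/-- In `ℝ[X]`, the `ℝ`-subalgebra generated by `X²` and `X³` is exactly the set
of polynomials whose coefficient of `X` is zero. -/
theorem adjoin_X_sq_X_cube_eq (f : ℝ[X]) :
    f ∈ Algebra.adjoin ℝ ({X ^ 2, X ^ 3} : Set ℝ[X]) ↔ f.coeff 1 = 0 := by
  constructor
  · intro hf
    induction hf using Algebra.adjoin_induction with
    | mem p hp => rcases hp with rfl | rfl <;> simp [coeff_X_pow]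
    | algebraMap r => simp [algebraMap_eq]
    | add p q _ _ hp hq => simp [hp, hq]
    | mul p q _ _ hp hq => simp [mul_coeff_one, hp, hq]
  · intro hf
    rw [f.as_sum_support_C_mul_X_pow]
    refine sum_mem fun n hn => ?_
    rw [← smul_eq_C_mul]
    refine Subalgebra.smul_mem _ (X_pow_mem_adjoin_X_sq_X_cube ?_) _
    rintro rfl
    exact mem_support_iff.mp hn hf
end

section
/- In the subring A = {f ∈ ℝ[X] : f.coeff 1 = 0} of ℝ[X], the ideal generated by X² and X³ equals the set {f ∈ A : f.coeff 0 = 0} of elements of A with zero constant term. -/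
open Polynomial

noncomputable def polySubringNoX : Subring ℝ[X] where
  carrier := {f : ℝ[X] | f.coeff 1 = 0}
  zero_mem' := by simp
  one_mem' := by simp [coeff_one]
  add_mem' := by
    intro a b ha hb
    simp only [Set.mem_setOf_eq, coeff_add] at *
    rw [ha, hb, add_zero]
  neg_mem' := by
    intro a ha
    simp only [Set.mem_setOf_eq, coeff_neg] at *
    rw [ha, neg_zero]
  mul_mem' := by
    intro a b ha hb
    simp only [Set.mem_setOf_eq] at *
    rw [coeff_mul]
    rw [show (1 : ℕ) = 0 + 1 from rfl, Finset.Nat.sum_antidiagonal_eq_sum_range_succ_mk]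
    simp [Finset.sum_range_succ, ha, hb]

theorem X_sq_mem : (X ^ 2 : ℝ[X]) ∈ polySubringNoX := by
  show (X ^ 2 : ℝ[X]).coeff 1 = 0
  simp [coeff_X_pow]

theorem X_cube_mem : (X ^ 3 : ℝ[X]) ∈ polySubringNoX := by
  show (X ^ 3 : ℝ[X]).coeff 1 = 0
  simp [coeff_X_pow]

/-- In `A = {f ∈ ℝ[X] : f.coeff 1 = 0} = ℝ[X², X³]`, the ideal generated by
`X²` and `X³` is exactly the set of elements of `A` with zero constant term. -/
theorem ideal_span_X_sq_X_cube (f : polySubringNoX) :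
    f ∈ Ideal.span ({⟨X ^ 2, X_sq_mem⟩, ⟨X ^ 3, X_cube_mem⟩} :
        Set polySubringNoX) ↔
      (f : ℝ[X]).coeff 0 = 0 := by
  rw [Ideal.mem_span_pair]
  constructor
  · rintro ⟨a, b, rfl⟩
    simp
  · intro h0
    have h1 : (f : ℝ[X]).coeff 1 = 0 := f.2
    obtain ⟨g, hg⟩ : X ^ 2 ∣ (f : ℝ[X]) := by
      rw [X_pow_dvd_iff]
      intro d hd
      interval_cases d
      exacts [h0, h1]
    have ha : g - C (g.coeff 1) * X ∈ polySubringNoX := by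
      change (g - C (g.coeff 1) * X).coeff 1 = 0
      simp
    have hb : C (g.coeff 1) ∈ polySubringNoX := by
      change (C (g.coeff 1)).coeff 1 = 0
      simp
    refine ⟨⟨_, ha⟩, ⟨_, hb⟩, Subtype.ext ?_⟩
    change (g - C (g.coeff 1) * X) * X ^ 2 + C (g.coeff 1) * X ^ 3 = (f : ℝ[X])
    rw [hg]
    ring
end

section
/- There do not exist n, d, u, v in the subring A = {f ∈ ℝ[X] : f.coeff 1 = 0} of ℝ[X] with d ≠ 0 such that (1 − X²)·n = (1 − X³)·d and u·n + v·d = 1. (Equivalently: the plant p = (1−X³)/(1−X²) ∈ ℝ(X) has no coprime factorization over A = ℝ[X², X³].) -/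
open Polynomial

theorem one_sub_X_sq_mem : (1 - X ^ 2 : ℝ[X]) ∈ polySubringNoX := by
  show (1 - X ^ 2 : ℝ[X]).coeff 1 = 0
  simp [coeff_X_pow, coeff_one]

theorem one_sub_X_cube_mem : (1 - X ^ 3 : ℝ[X]) ∈ polySubringNoX := by
  show (1 - X ^ 3 : ℝ[X]).coeff 1 = 0
  simp [coeff_X_pow, coeff_one]

/-- The plant `p = (1-X³)/(1-X²)` has no coprime factorization over
`A = {f ∈ ℝ[X] : f.coeff 1 = 0} = ℝ[X², X³]`: there are no `n, d, u, v ∈ A`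
with `d ≠ 0`, `(1-X²)·n = (1-X³)·d` and `u·n + v·d = 1`. -/
theorem no_coprime_factorization_delay_plant :
    ¬ ∃ n d u v : polySubringNoX, d ≠ 0 ∧
      (⟨1 - X ^ 2, one_sub_X_sq_mem⟩ : polySubringNoX) * n =
        (⟨1 - X ^ 3, one_sub_X_cube_mem⟩ : polySubringNoX) * d ∧
      u * n + v * d = 1 := by
  rintro ⟨⟨n, hn⟩, ⟨d, hd⟩, ⟨u, hu⟩, ⟨v, hv⟩, -, hnd, huv⟩
  replace hnd : (1 - X ^ 2) * n = (1 - X ^ 3) * d := congrArg Subtype.val hnd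
  replace huv : u * n + v * d = 1 := congrArg Subtype.val huv
  replace hd : d.coeff 1 = 0 := hd
  have h1X : (1 - X : ℝ[X]) ≠ 0 := by
    intro h
    simpa using congrArg (eval 0) h
  have hcancel : (1 + X) * n = (1 + X + X ^ 2) * d :=
    mul_left_cancel₀ h1X (by linear_combination hnd)
  have hdw : d = (1 + X) * (n - X * d) := by linear_combination -hcancel
  have hnw : n = (1 + X + X ^ 2) * (n - X * d) := by linear_combination -X * hcancel
  have hunit : IsUnit (n - X * d) :=
    IsUnit.of_mul_eq_one (u * (1 + X + X ^ 2) + v * (1 + X))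
      (by linear_combination huv - u * hnw - v * hdw)
  obtain ⟨c, hc, hcw⟩ := Polynomial.isUnit_iff.mp hunit
  rw [← hcw] at hdw
  apply hc.ne_zero
  rw [hdw] at hd
  simpa [coeff_one] using hd
end

section
/- Let n, d ∈ ℝ[X] with n.coeff 1 = 0 and d.coeff 1 = 0, and suppose n and d are coprime in ℝ[X] (i.e. there exist α, β ∈ ℝ[X] with α·n + β·d = 1). Then there exist α', β' ∈ ℝ[X] with α'.coeff 1 = 0 and β'.coeff 1 = 0 such that α'·n + β'·d = 1. (A Bézout identity over ℝ[X] between elements of A = ℝ[X², X³] can always be corrected, by replacing (α, β) with (α + r·d, β − r·n) for suitable r ∈ ℝ[X], into a Bézout identity over A.) -/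
open Polynomial

/-- A Bézout identity in `ℝ[X]` between two elements of the subring
`A = ℝ[X², X³] = {f : f.coeff 1 = 0}` can be corrected to a Bézout identity
with cofactors in `A`. -/
theorem bezout_correction (n d : ℝ[X]) (hn : n.coeff 1 = 0) (hd : d.coeff 1 = 0)
    (h : IsCoprime n d) :
    ∃ α' β' : ℝ[X], α'.coeff 1 = 0 ∧ β'.coeff 1 = 0 ∧ α' * n + β' * d = 1 := by
  obtain ⟨α, β, hαβ⟩ := h
  have h₀ : α.coeff 0 * n.coeff 0 + β.coeff 0 * d.coeff 0 = 1 := by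
    simpa only [coeff_add, mul_coeff_zero, coeff_one_zero] using congrArg (coeff · 0) hαβ
  have h₁ : α.coeff 1 * n.coeff 0 + β.coeff 1 * d.coeff 0 = 0 := by
    simpa [mul_coeff_one, hn, hd, coeff_one] using congrArg (coeff · 1) hαβ
  let c : ℝ := α.coeff 0 * β.coeff 1 - α.coeff 1 * β.coeff 0
  have hr (f : ℝ[X]) : (C c * X * f).coeff 1 = c * f.coeff 0 := by
    simp [mul_coeff_one]
  refine ⟨α + C c * X * d, β - C c * X * n, ?_, ?_, ?_⟩
  · rw [coeff_add, hr]
    linear_combination α.coeff 0 * h₁ - α.coeff 1 * h₀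
  · rw [coeff_sub, hr]
    linear_combination β.coeff 0 * h₁ - β.coeff 1 * h₀
  · linear_combination hαβ
end

section
/- Let n, d ∈ ℝ[X] with n.coeff 1 = 0, d.coeff 1 = 0, n ≠ 0, and d.coeff 0 ≠ 0. Then there exist λ₁, λ₂, a, b ∈ ℝ[X], each with coefficient of X equal to zero, such that λ₁ + λ₂ = 1, λ₁·d = a·n, and λ₂·n = b·d. (This is the algebraic content of the proposition that every causal transfer function p = n/d over A = ℝ[X², X³] is stabilizable: the two generalized elementary factor ideals Λ₁ = {λ ∈ A : λ·(d/n) ∈ A} and Λ₂ = {λ ∈ A : λ·(n/d) ∈ A} satisfy Λ₁ + Λ₂ = A.) -/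
open Polynomial

/-- A polynomial over a field with nonzero constant term is coprime to every power of `X`. -/
theorem isCoprime_X_pow_of_coeff_zero_ne_zero {K : Type*} [Field K] {p : K[X]}
    (hp : p.coeff 0 ≠ 0) (k : ℕ) : IsCoprime (X ^ k) p :=
  ((irreducible_X.coprime_iff_not_dvd).2 (by rwa [X_dvd_iff])).pow_left

/-- Every causal transfer function `p = n/d` over `A = ℝ[X², X³]`
(`n ≠ 0`, `d` with nonzero constant term) is stabilizable: the generalized
elementary factor ideals sum to `A`, i.e. there are `λ₁, λ₂, a, b ∈ A` with
`λ₁ + λ₂ = 1`, `λ₁·d = a·n` and `λ₂·n = b·d`. -/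
theorem causal_plant_stabilizable (n d : ℝ[X]) (hn1 : n.coeff 1 = 0)
    (hd1 : d.coeff 1 = 0) (hn : n ≠ 0) (hd0 : d.coeff 0 ≠ 0) :
    ∃ lam1 lam2 a b : ℝ[X],
      lam1.coeff 1 = 0 ∧ lam2.coeff 1 = 0 ∧ a.coeff 1 = 0 ∧ b.coeff 1 = 0 ∧
      lam1 + lam2 = 1 ∧ lam1 * d = a * n ∧ lam2 * n = b * d := by
  let := EuclideanDomain.gcdMonoid ℝ[X]
  obtain ⟨n', d', hn', hd', hunit⟩ := extract_gcd n d
  generalize gcd n d = g at hn' hd'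
  have hd0' : d'.coeff 0 ≠ 0 := by
    rw [hd', mul_coeff_zero] at hd0
    exact right_ne_zero_of_mul hd0
  obtain ⟨u, v, huv⟩ := (isCoprime_X_pow_of_coeff_zero_ne_zero hd0' 2).mul_left
    ((gcd_isUnit_iff n' d').1 hunit)
  have coeff_one_X_sq_mul (p : ℝ[X]) : (X ^ 2 * p).coeff 1 = 0 := by
    simp [coeff_X_pow_mul']
  have hlam2 : v * d' = 1 - X ^ 2 * (u * n') := by linear_combination huv
  have hlam2_coeff : (v * d').coeff 1 = 0 := by
    rw [hlam2, coeff_sub, coeff_one_X_sq_mul]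
    simp [coeff_one]
  have hb : v * d' * n = v * n' * d := by rw [hn', hd']; ring
  refine ⟨X ^ 2 * (u * n'), v * d', X ^ 2 * (u * d'), v * n', coeff_one_X_sq_mul _,
    hlam2_coeff, coeff_one_X_sq_mul _, ?_, by rw [hlam2]; ring, by rw [hn', hd']; ring, hb⟩
  have h := congrArg (coeff · 1) hb
  simpa [mul_coeff_one (v * d'), mul_coeff_one (v * n'), hlam2_coeff, hn1, hd1, hd0]
    using h
end

section
/- In the field of rational functions ℝ(X), let p = (1 − X³)/(1 − X²) and let c = (−101 + 255X² − 343X³ − 56X⁴ + 343X⁵ − 98X⁶)/(1089 − 154X² + 242X³ − 98X⁴ + 154X⁵ − 343X⁶ + 98X⁷). Then 1 + p·c ≠ 0, and each of (1+p·c)⁻¹, p·(1+p·c)⁻¹, c·(1+p·c)⁻¹ and p·c·(1+p·c)⁻¹ lies in the image of the subring A = {f ∈ ℝ[X] : f.coeff 1 = 0} in ℝ(X). (Thus c is a stabilizing controller of the plant p over A = ℝ[X², X³].) -/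
open Polynomial

theorem mem_polySubringNoX {f : ℝ[X]} : f ∈ polySubringNoX ↔ f.coeff 1 = 0 := Iff.rfl

theorem C_mem_polySubringNoX (r : ℝ) : C r ∈ polySubringNoX := by
  simp [mem_polySubringNoX]

theorem ofNat_mul_X_pow_mem_polySubringNoX (m n : ℕ) [m.AtLeastTwo] (hn : n ≠ 1) :
    (OfNat.ofNat m : ℝ[X]) * X ^ n ∈ polySubringNoX := by
  rw [mem_polySubringNoX, coeff_ofNat_mul, coeff_X_pow, if_neg hn.symm, mul_zero]

/-- A fraction `f / r` with `f ∈ A` and `r` a real constant lies in the image of `A`. -/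
theorem div_C_mem_image_polySubringNoX {f : ℝ[X]} (hf : f ∈ polySubringNoX) {r : ℝ} (hr : r ≠ 0) :
    algebraMap ℝ[X] (RatFunc ℝ) f / algebraMap ℝ[X] (RatFunc ℝ) (C r) ∈
      algebraMap ℝ[X] (RatFunc ℝ) '' (polySubringNoX : Set ℝ[X]) := by
  refine ⟨f * C r⁻¹, mul_mem hf (C_mem_polySubringNoX _), ?_⟩
  have hC : algebraMap ℝ[X] (RatFunc ℝ) (C r) ≠ 0 := by simpa using hr
  rw [eq_div_iff hC, ← map_mul, mul_assoc, ← C_mul, inv_mul_cancel₀ hr, C_1, mul_one]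

/-- In `ℝ(X)`, the controller
`c = (-101 + 255X² - 343X³ - 56X⁴ + 343X⁵ - 98X⁶) /
     (1089 - 154X² + 242X³ - 98X⁴ + 154X⁵ - 343X⁶ + 98X⁷)`
stabilizes the plant `p = (1-X³)/(1-X²)` over `A = ℝ[X², X³]`: one has
`1 + p·c ≠ 0` and each of `(1+pc)⁻¹`, `p(1+pc)⁻¹`, `c(1+pc)⁻¹`, `pc(1+pc)⁻¹`
lies in the image of `A` in `ℝ(X)`. -/
theorem stabilizing_controller_delay_plant :
    let φ := algebraMap ℝ[X] (RatFunc ℝ)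
    let p : RatFunc ℝ := φ (1 - X ^ 3) / φ (1 - X ^ 2)
    let c : RatFunc ℝ :=
      φ (-101 + 255 * X ^ 2 - 343 * X ^ 3 - 56 * X ^ 4 + 343 * X ^ 5 - 98 * X ^ 6) /
      φ (1089 - 154 * X ^ 2 + 242 * X ^ 3 - 98 * X ^ 4 + 154 * X ^ 5 - 343 * X ^ 6
          + 98 * X ^ 7)
    1 + p * c ≠ 0 ∧
    (1 + p * c)⁻¹ ∈ φ '' (polySubringNoX : Set ℝ[X]) ∧
    p * (1 + p * c)⁻¹ ∈ φ '' (polySubringNoX : Set ℝ[X]) ∧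
    c * (1 + p * c)⁻¹ ∈ φ '' (polySubringNoX : Set ℝ[X]) ∧
    p * c * (1 + p * c)⁻¹ ∈ φ '' (polySubringNoX : Set ℝ[X]) := by
  intro φ p c
  set n : ℝ[X] := 1 - X ^ 3 with hn
  set d : ℝ[X] := 1 - X ^ 2 with hd
  set a : ℝ[X] :=
    -101 + 255 * X ^ 2 - 343 * X ^ 3 - 56 * X ^ 4 + 343 * X ^ 5 - 98 * X ^ 6 with ha
  set b : ℝ[X] :=
    1089 - 154 * X ^ 2 + 242 * X ^ 3 - 98 * X ^ 4 + 154 * X ^ 5 - 343 * X ^ 6 + 98 * X ^ 7 with hb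
  have hp : p = φ n / φ d := rfl
  have hc : c = φ a / φ b := rfl
  -- the quotient `n * b / d`
  let q : ℝ[X] :=
    1089 + 935 * X ^ 2 - 847 * X ^ 3 + 837 * X ^ 4 - 539 * X ^ 5 + 252 * X ^ 6 - 343 * X ^ 7
      + 98 * X ^ 8
  have mem (m k : ℕ) [m.AtLeastTwo] (hk : k ≠ 1) := ofNat_mul_X_pow_mem_polySubringNoX m k hk
  have ha_mem : a ∈ polySubringNoX := by
    refine sub_mem (add_mem (sub_mem (sub_mem (add_mem (neg_mem (ofNat_mem _ 101))
      ?_) ?_) ?_) ?_) ?_ <;>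
      exact mem _ _ (by norm_num)
  have hb_mem : b ∈ polySubringNoX := by
    refine add_mem (sub_mem (add_mem (sub_mem (add_mem (sub_mem (ofNat_mem _ 1089)
      ?_) ?_) ?_) ?_) ?_) ?_ <;>
      exact mem _ _ (by norm_num)
  have hq_mem : q ∈ polySubringNoX := by
    refine add_mem (sub_mem (add_mem (sub_mem (add_mem (sub_mem (add_mem (ofNat_mem _ 1089)
      ?_) ?_) ?_) ?_) ?_) ?_) ?_ <;>
      exact mem _ _ (by norm_num)
  have hC : (C 988 : ℝ[X]) = 988 := rfl
  have bezout : d * b + n * a = C 988 * d := by rw [hC, hn, hd, ha, hb]; ring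
  have hnb : n * b = q * d := by rw [hn, hd, hb]; ring
  have ne_zero_of_eval {f : ℝ[X]} (hf : f.eval 0 ≠ 0) : φ f ≠ 0 :=
    (map_ne_zero_iff φ (RatFunc.algebraMap_injective ℝ)).2 fun h => hf (by simp [h])
  have hd0 : φ d ≠ 0 := ne_zero_of_eval (by simp [hd])
  have hb0 : φ b ≠ 0 := ne_zero_of_eval (by simp [hb])
  have hC0 : φ (C 988) ≠ 0 := ne_zero_of_eval (by simp)
  have bezout' : φ d * φ b + φ n * φ a = φ (C 988) * φ d := by
    simp only [← map_mul, ← map_add, bezout]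
  have hnb' : φ n * φ b = φ q * φ d := by simp only [← map_mul, hnb]
  have hpc : 1 + p * c = φ (C 988) / φ b := by
    rw [hp, hc]
    field_simp
    linear_combination bezout'
  have hpc0 : 1 + p * c ≠ 0 := hpc ▸ div_ne_zero hC0 hb0
  have hinv : (1 + p * c)⁻¹ = φ b / φ (C 988) := by rw [hpc, inv_div]
  have hr : (988 : ℝ) ≠ 0 := by norm_num
  have hS : (1 + p * c)⁻¹ ∈ φ '' (polySubringNoX : Set ℝ[X]) :=
    hinv ▸ div_C_mem_image_polySubringNoX hb_mem hr
  refine ⟨hpc0, hS, ?_, ?_, ?_⟩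
  · have : p * (1 + p * c)⁻¹ = φ q / φ (C 988) := by
      rw [hinv, hp]
      field_simp
      linear_combination hnb'
    exact this ▸ div_C_mem_image_polySubringNoX hq_mem hr
  · have : c * (1 + p * c)⁻¹ = φ a / φ (C 988) := by
      rw [hinv, hc]
      field_simp
    exact this ▸ div_C_mem_image_polySubringNoX ha_mem hr
  · obtain ⟨s, hs, hs'⟩ := hS
    refine ⟨1 - s, sub_mem (one_mem _) hs, ?_⟩
    rw [map_sub, map_one, hs']
    field_simp
    ring
end
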